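/- Morley–Poncelet corollary (via condition (2) of Theorem 1): in any triangle ABC with trisector cevians AA₁, BB₁, CC₁ and AA₂, BB₂, CC₂, the six pairwise intersection points X₁ = BB₁ ∩ CC₁, Y₁ = AA₁ ∩ CC₁, Z₁ = AA₁ ∩ BB₁, X₂ = BB₂ ∩ CC₂, Y₂ = AA₂ ∩ CC₂, Z₂ = AA₂ ∩ BB₂ are conconic. -/

import Mathlib

open EuclideanGeometry

abbrev Pt := EuclideanSpace ℝ (Fin 2)

/-- Six (or any set of) points lie on a common conic: a nonzero quadratic equation
vanishes at each of them. -/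
def Conconic (s : Set Pt) : Prop :=
  ∃ a b c d e f : ℝ, (a, b, c, d, e, f) ≠ (0, 0, 0, 0, 0, 0) ∧
    ∀ P ∈ s, a * (P 0) ^ 2 + b * (P 0) * (P 1) + c * (P 1) ^ 2 + d * (P 0) + e * (P 1) + f = 0

/-- Twice the signed area of the triangle `PQR`. -/
def cross (P Q R : Pt) : ℝ :=
  (Q 0 - P 0) * (R 1 - P 1) - (Q 1 - P 1) * (R 0 - P 0)

lemma cross_ne_zero_of_affineIndependent {A B C : Pt} (h : AffineIndependent ℝ ![A, B, C]) :
    cross A B C ≠ 0 := by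
  intro h0
  have hAB : A ≠ B := fun e => by
    simpa using h.injective (a₁ := 0) (a₂ := 1) e
  rw [affineIndependent_iff_not_collinear_set] at h
  apply h
  have key : ∃ t : ℝ, C = AffineMap.lineMap A B t := by
    unfold cross at h0
    by_cases hx : B 0 - A 0 = 0
    · have hy : B 1 - A 1 ≠ 0 := fun hy => hAB <| by
        ext i
        fin_cases i
        · exact (sub_eq_zero.1 hx).symm
        · exact (sub_eq_zero.1 hy).symm
      refine ⟨(C 1 - A 1) / (B 1 - A 1), ?_⟩
      ext i
      fin_cases i <;> simp [AffineMap.lineMap_apply] <;> field_simp <;> [linear_combination -h0; ring]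
    · refine ⟨(C 0 - A 0) / (B 0 - A 0), ?_⟩
      ext i
      fin_cases i <;> simp [AffineMap.lineMap_apply] <;> field_simp <;> [ring; linear_combination h0]
  obtain ⟨t, rfl⟩ := key
  have := collinear_insert_of_mem_affineSpan_pair (AffineMap.lineMap_mem_affineSpan_pair t A B)
  convert! this using 1
  ext x
  simp
  tauto

/-- The ratio in which a cevian foot divides the opposite side, by the law of sines. -/
lemma dist_mul_dist_mul_sin_eq {A B C D : Pt} (hABC : AffineIndependent ℝ ![A, B, C])
    (hD : Sbtw ℝ B D C) :
    dist B D * dist A C * Real.sin (∠ D A C) = dist C D * dist A B * Real.sin (∠ B A D) := by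
  have hpi := angle_add_angle_eq_pi_of_angle_eq_pi A hD.angle₁₂₃_eq_pi
  have hsin : Real.sin (∠ A D B) = Real.sin (∠ A D C) := by
    rw [← Real.sin_pi_sub, ← hpi]; ring_nf
  have hne : Real.sin (∠ A D B) ≠ 0 := by
    refine (sin_pos_of_not_collinear fun hcol => ?_).ne'
    rw [affineIndependent_iff_not_collinear_set] at hABC
    apply hABC
    have hBD : B ≠ D := hD.left_ne
    have hC : C ∈ line[ℝ, B, D] := hD.wbtw.right_mem_affineSpan_of_left_ne hBD
    have hA : A ∈ line[ℝ, B, D] := by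
      refine hcol.mem_affineSpan_of_mem_of_ne ?_ ?_ ?_ hBD <;> simp
    have := collinear_insert_insert_of_mem_affineSpan_pair hA hC
    exact this.subset (by intro x; simp; tauto)
  have h₁ := law_sin A D B
  have h₂ := law_sin A D C
  rw [dist_comm D B, dist_comm B A] at h₁
  rw [dist_comm D C, dist_comm C A, ← hsin] at h₂
  apply mul_left_cancel₀ hne
  rw [angle_comm D A C, angle_comm B A D]
  rw [angle_comm B A D] at h₁
  linear_combination dist A C * Real.sin (∠ C A D) * h₁ - dist A B * Real.sin (∠ D A B) * h₂

lemma exists_ratio_of_sbtw {B C D : Pt} (A : Pt) (hD : Sbtw ℝ B D C) :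
    ∃ k : ℝ, dist B D = k * dist C D ∧
      ∀ P ∈ line[ℝ, A, D], cross P A B = k * cross P C A := by
  have hCD : dist C D ≠ 0 := dist_ne_zero.2 hD.right_ne
  obtain ⟨⟨t, ⟨ht0, ht1⟩, rfl⟩, hB, hC⟩ := hD
  have ht : 1 - t ≠ 0 := fun h => hC <| by
    rw [show t = 1 by linarith, AffineMap.lineMap_apply_one]
  refine ⟨t / (1 - t), ?_, fun P hP => ?_⟩
  · rw [dist_left_lineMap, dist_right_lineMap, Real.norm_of_nonneg ht0,
      Real.norm_of_nonneg (by linarith)]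
    field_simp
  · obtain ⟨s, rfl⟩ := mem_affineSpan_pair_iff_exists_lineMap_eq.1 hP
    simp only [cross, AffineMap.lineMap_apply, PiLp.add_apply, PiLp.smul_apply, vsub_eq_sub,
      vadd_eq_add, PiLp.sub_apply, smul_eq_mul]
    field_simp
    ring

lemma exists_ratios_of_trisectors {A B C D₁ D₂ : Pt} (hABC : AffineIndependent ℝ ![A, B, C])
    (hD₁ : Sbtw ℝ B D₁ C) (ha₁ : ∠ B A D₁ = ∠ B A C / 3)
    (hD₂ : Sbtw ℝ B D₂ C) (ha₂ : ∠ C A D₂ = ∠ B A C / 3) :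
    ∃ k₁ k₂ : ℝ, k₁ * k₂ * dist A C ^ 2 = dist A B ^ 2 ∧
      (∀ P ∈ line[ℝ, A, D₁], cross P A B = k₁ * cross P C A) ∧
      (∀ P ∈ line[ℝ, A, D₂], cross P A B = k₂ * cross P C A) := by
  obtain ⟨k₁, hk₁, hl₁⟩ := exists_ratio_of_sbtw A hD₁
  obtain ⟨k₂, hk₂, hl₂⟩ := exists_ratio_of_sbtw A hD₂
  refine ⟨k₁, k₂, ?_, hl₁, hl₂⟩
  have e₁ := dist_mul_dist_mul_sin_eq hABC hD₁
  have e₂ := dist_mul_dist_mul_sin_eq hABC hD₂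
  have s₁ := angle_add_angle_eq_of_sbtw (p := A) hD₁
  have s₂ := angle_add_angle_eq_of_sbtw (p := A) hD₂
  rw [angle_comm] at ha₂
  rw [hk₁, ha₁, show ∠ D₁ A C = 2 * (∠ B A C / 3) by linarith] at e₁
  rw [hk₂, ha₂, show ∠ B A D₂ = 2 * (∠ B A C / 3) by linarith] at e₂
  have hcol := affineIndependent_iff_not_collinear_set.1 hABC
  have hcol' : ¬ Collinear ℝ ({B, A, C} : Set Pt) := by rwa [Set.insert_comm]
  have hpos := angle_pos_of_not_collinear hcol'
  have hlt := angle_lt_pi_of_not_collinear hcol'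
  have hx : Real.sin (∠ B A C / 3) ≠ 0 :=
    (Real.sin_pos_of_pos_of_lt_pi (by linarith) (by linarith)).ne'
  have hy : Real.sin (2 * (∠ B A C / 3)) ≠ 0 :=
    (Real.sin_pos_of_pos_of_lt_pi (by linarith) (by linarith)).ne'
  have hd₁ : dist C D₁ ≠ 0 := dist_ne_zero.2 hD₁.right_ne
  have hd₂ : dist C D₂ ≠ 0 := dist_ne_zero.2 hD₂.right_ne
  apply mul_left_cancel₀ (mul_ne_zero (mul_ne_zero hx hy) (mul_ne_zero hd₁ hd₂))
  linear_combination k₂ * dist C D₂ * dist A C * Real.sin (∠ B A C / 3) * e₁ +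
    dist C D₁ * dist A B * Real.sin (∠ B A C / 3) * e₂

/-- The pencil of conics through the vertices of one triangle of cevians contains a nonzero
member through the vertices of the other, in unnormalized barycentric coordinates. -/
lemma exists_barycentric_conic {k₁ k₂ l₁ l₂ m₁ m₂ : ℝ} (h : k₁ * k₂ * (l₁ * l₂) * (m₁ * m₂) = 1) :
    ∃ x y z : ℝ, (x ≠ 0 ∨ y ≠ 0 ∨ z ≠ 0) ∧ ∀ u v w : ℝ,
      (u = l₂ * w ∧ v = m₂ * u ∨ w = k₂ * v ∧ v = m₂ * u ∨ w = k₂ * v ∧ u = l₂ * w) →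
      x * ((u - l₁ * w) * (v - m₁ * u)) + y * ((w - k₁ * v) * (v - m₁ * u)) +
        z * ((w - k₁ * v) * (u - l₁ * w)) = 0 := by
  let M : Matrix (Fin 3) (Fin 3) ℝ := !![
    (l₂ - l₁) * (l₂ * (m₂ - m₁)), (1 - k₁ * l₂ * m₂) * (l₂ * (m₂ - m₁)),
      (1 - k₁ * l₂ * m₂) * (l₂ - l₁);
    (1 - l₁ * k₂ * m₂) * (m₂ - m₁), m₂ * (k₂ - k₁) * (m₂ - m₁),
      m₂ * (k₂ - k₁) * (1 - l₁ * k₂ * m₂);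
    k₂ * (l₂ - l₁) * (1 - m₁ * k₂ * l₂), (k₂ - k₁) * (1 - m₁ * k₂ * l₂),
      (k₂ - k₁) * (k₂ * (l₂ - l₁))]
  have hM : M.det = 0 := by
    rw [Matrix.det_fin_three]
    simp only [M, Matrix.of_apply, Matrix.cons_val', Matrix.cons_val_zero, Matrix.cons_val_one,
      Matrix.cons_val]
    linear_combination
      -((k₂ - k₁) * (l₂ - l₁) * (m₂ - m₁) * (k₂ * l₂ * m₂ - 1) ^ 2) * h
  obtain ⟨c, hc, hMc⟩ := Matrix.exists_mulVec_eq_zero_iff.2 hM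
  have r0 := congrFun hMc 0
  have r1 := congrFun hMc 1
  have r2 := congrFun hMc 2
  simp [M, Matrix.mulVec, dotProduct, Fin.sum_univ_three] at r0 r1 r2
  refine ⟨c 0, c 1, c 2, ?_, ?_⟩
  · by_contra! h0
    exact hc (by ext i; fin_cases i <;> simp [h0])
  · rintro u v w (⟨rfl, rfl⟩ | ⟨rfl, rfl⟩ | ⟨rfl, rfl⟩)
    · linear_combination w ^ 2 * r0
    · linear_combination u ^ 2 * r1
    · linear_combination v ^ 2 * r2

lemma exists_affine_coeffs (P₁ Q₁ P₂ Q₂ : Pt) (k : ℝ) :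
    ∃ p q r : ℝ, ∀ P, cross P P₁ Q₁ - k * cross P P₂ Q₂ = p * P 0 + q * P 1 + r :=
  ⟨P₁ 1 - Q₁ 1 - k * (P₂ 1 - Q₂ 1), Q₁ 0 - P₁ 0 - k * (Q₂ 0 - P₂ 0),
    P₁ 0 * Q₁ 1 - P₁ 1 * Q₁ 0 - k * (P₂ 0 * Q₂ 1 - P₂ 1 * Q₂ 0), fun P => by unfold cross; ring⟩

/-- The zero locus of a combination of pairwise products of three affine functions is a conic,
as soon as the combination is not identically zero. -/
lemma conconic_of_affine_products {s : Set Pt} (g₁ g₂ g₃ : Pt → ℝ) (x y z : ℝ)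
    (h₁ : ∃ p q r : ℝ, ∀ P, g₁ P = p * P 0 + q * P 1 + r)
    (h₂ : ∃ p q r : ℝ, ∀ P, g₂ P = p * P 0 + q * P 1 + r)
    (h₃ : ∃ p q r : ℝ, ∀ P, g₃ P = p * P 0 + q * P 1 + r)
    (hne : ∃ Q, x * (g₂ Q * g₃ Q) + y * (g₁ Q * g₃ Q) + z * (g₁ Q * g₂ Q) ≠ 0)
    (hs : ∀ P ∈ s, x * (g₂ P * g₃ P) + y * (g₁ P * g₃ P) + z * (g₁ P * g₂ P) = 0) :
    Conconic s := by
  obtain ⟨p₁, q₁, r₁, h₁⟩ := h₁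
  obtain ⟨p₂, q₂, r₂, h₂⟩ := h₂
  obtain ⟨p₃, q₃, r₃, h₃⟩ := h₃
  obtain ⟨a, b, c, d, e, f, hF⟩ : ∃ a b c d e f : ℝ, ∀ P : Pt,
      x * (g₂ P * g₃ P) + y * (g₁ P * g₃ P) + z * (g₁ P * g₂ P) =
        a * (P 0) ^ 2 + b * (P 0) * (P 1) + c * (P 1) ^ 2 + d * (P 0) + e * (P 1) + f := by
    refine ⟨x * (p₂ * p₃) + y * (p₁ * p₃) + z * (p₁ * p₂),
      x * (p₂ * q₃ + q₂ * p₃) + y * (p₁ * q₃ + q₁ * p₃) + z * (p₁ * q₂ + q₁ * p₂),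
      x * (q₂ * q₃) + y * (q₁ * q₃) + z * (q₁ * q₂),
      x * (p₂ * r₃ + r₂ * p₃) + y * (p₁ * r₃ + r₁ * p₃) + z * (p₁ * r₂ + r₁ * p₂),
      x * (q₂ * r₃ + r₂ * q₃) + y * (q₁ * r₃ + r₁ * q₃) + z * (q₁ * r₂ + r₁ * q₂),
      x * (r₂ * r₃) + y * (r₁ * r₃) + z * (r₁ * r₂), fun P => ?_⟩
    rw [h₁, h₂, h₃]
    ring
  obtain ⟨Q, hQ⟩ := hne
  refine ⟨a, b, c, d, e, f, fun h0 => hQ ?_, fun P hP => (hF P).symm.trans (hs P hP)⟩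
  simp only [Prod.mk.injEq] at h0
  obtain ⟨rfl, rfl, rfl, rfl, rfl, rfl⟩ := h0
  rw [hF]
  ring

/-- Morley–Poncelet corollary: the six pairwise intersection points of the two triples
of trisector cevians of a triangle are conconic. -/
theorem morley_trisector_intersections_conconic
    (A B C A₁ A₂ B₁ B₂ C₁ C₂ X₁ X₂ Y₁ Y₂ Z₁ Z₂ : Pt)
    (hABC : AffineIndependent ℝ ![A, B, C])
    (hA₁ : Sbtw ℝ B A₁ C) (haA₁ : ∠ B A A₁ = ∠ B A C / 3)
    (hA₂ : Sbtw ℝ B A₂ C) (haA₂ : ∠ C A A₂ = ∠ B A C / 3)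
    (hB₁ : Sbtw ℝ C B₁ A) (haB₁ : ∠ C B B₁ = ∠ A B C / 3)
    (hB₂ : Sbtw ℝ C B₂ A) (haB₂ : ∠ A B B₂ = ∠ A B C / 3)
    (hC₁ : Sbtw ℝ A C₁ B) (haC₁ : ∠ A C C₁ = ∠ B C A / 3)
    (hC₂ : Sbtw ℝ A C₂ B) (haC₂ : ∠ B C C₂ = ∠ B C A / 3)
    (hX₁ : (line[ℝ, B, B₁] : Set Pt) ∩ (line[ℝ, C, C₁] : Set Pt) = {X₁})
    (hY₁ : (line[ℝ, A, A₁] : Set Pt) ∩ (line[ℝ, C, C₁] : Set Pt) = {Y₁})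
    (hZ₁ : (line[ℝ, A, A₁] : Set Pt) ∩ (line[ℝ, B, B₁] : Set Pt) = {Z₁})
    (hX₂ : (line[ℝ, B, B₂] : Set Pt) ∩ (line[ℝ, C, C₂] : Set Pt) = {X₂})
    (hY₂ : (line[ℝ, A, A₂] : Set Pt) ∩ (line[ℝ, C, C₂] : Set Pt) = {Y₂})
    (hZ₂ : (line[ℝ, A, A₂] : Set Pt) ∩ (line[ℝ, B, B₂] : Set Pt) = {Z₂}) :
    Conconic {X₁, X₂, Y₁, Y₂, Z₁, Z₂} := by
  have hS := cross_ne_zero_of_affineIndependent hABC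
  have hBCA : AffineIndependent ℝ ![B, C, A] := by
    rw [affineIndependent_iff_not_collinear_set] at hABC ⊢
    rwa [show ({B, C, A} : Set Pt) = {A, B, C} by ext; simp; tauto]
  have hCAB : AffineIndependent ℝ ![C, A, B] := by
    rw [affineIndependent_iff_not_collinear_set] at hABC ⊢
    rwa [show ({C, A, B} : Set Pt) = {A, B, C} by ext; simp; tauto]
  obtain ⟨k₁, k₂, hk, hk₁, hk₂⟩ := exists_ratios_of_trisectors hABC hA₁ haA₁ hA₂ haA₂
  rw [angle_comm A B C] at haB₁ haB₂
  obtain ⟨l₁, l₂, hl, hl₁, hl₂⟩ := exists_ratios_of_trisectors hBCA hB₁ haB₁ hB₂ haB₂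
  rw [angle_comm B C A] at haC₁ haC₂
  obtain ⟨m₁, m₂, hm, hm₁, hm₂⟩ := exists_ratios_of_trisectors hCAB hC₁ haC₁ hC₂ haC₂
  have hAB : dist A B ≠ 0 := dist_ne_zero.2 hC₁.left_ne_right
  have hBC : dist B C ≠ 0 := dist_ne_zero.2 hA₁.left_ne_right
  have hCA : dist C A ≠ 0 := dist_ne_zero.2 hB₁.left_ne_right
  rw [dist_comm A C] at hk
  rw [dist_comm B A] at hl
  rw [dist_comm C B] at hm
  have hprod : k₁ * k₂ * (l₁ * l₂) * (m₁ * m₂) = 1 := by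
    apply mul_left_cancel₀ (pow_ne_zero 2 (mul_ne_zero (mul_ne_zero hAB hBC) hCA))
    calc _ = (k₁ * k₂ * dist C A ^ 2) * (l₁ * l₂ * dist A B ^ 2) * (m₁ * m₂ * dist B C ^ 2) := by
          ring
      _ = _ := by rw [hk, hl, hm]; ring
  have hne : k₁ ≠ 0 ∧ l₁ ≠ 0 ∧ m₁ ≠ 0 := by
    refine ⟨?_, ?_, ?_⟩ <;> rintro rfl <;> simp at hprod
  obtain ⟨x, y, z, hxyz, hconic⟩ := exists_barycentric_conic hprod
  have mem {P : Pt} {s t : Set Pt} (h : s ∩ t = {P}) : P ∈ s ∧ P ∈ t := by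
    have : P ∈ s ∩ t := h ▸ rfl
    exact this
  obtain ⟨x₁, x₁'⟩ := mem hX₁
  obtain ⟨x₂, x₂'⟩ := mem hX₂
  obtain ⟨y₁, y₁'⟩ := mem hY₁
  obtain ⟨y₂, y₂'⟩ := mem hY₂
  obtain ⟨z₁, z₁'⟩ := mem hZ₁
  obtain ⟨z₂, z₂'⟩ := mem hZ₂
  refine conconic_of_affine_products (fun P => cross P A B - k₁ * cross P C A)
    (fun P => cross P B C - l₁ * cross P A B) (fun P => cross P C A - m₁ * cross P B C) x y z
    (exists_affine_coeffs ..) (exists_affine_coeffs ..) (exists_affine_coeffs ..) ?_ ?_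
  · by_contra! h0
    have vA : cross A A B = 0 ∧ cross A C A = 0 ∧ cross A B C = cross A B C := by
      simp [cross]
    have vB : cross B A B = 0 ∧ cross B B C = 0 ∧ cross B C A = cross A B C := by
      simp [cross]; ring
    have vC : cross C C A = 0 ∧ cross C B C = 0 ∧ cross C A B = cross A B C := by
      simp [cross]; ring
    have hA := h0 A
    have hB := h0 B
    have hC := h0 C
    simp only [vA] at hA
    simp only [vB] at hB
    simp only [vC] at hC
    simp [hS, hne] at hA hB hC
    tauto
  · simp only [Set.mem_insert_iff, Set.mem_singleton_iff]
    rintro P (rfl | rfl | rfl | rfl | rfl | rfl)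
    · simp [hl₁ _ x₁, hm₁ _ x₁']
    · exact hconic _ _ _ (.inl ⟨hl₂ _ x₂, hm₂ _ x₂'⟩)
    · simp [hk₁ _ y₁, hm₁ _ y₁']
    · exact hconic _ _ _ (.inr (.inl ⟨hk₂ _ y₂, hm₂ _ y₂'⟩))
    · simp [hk₁ _ z₁, hl₁ _ z₁']
    · exact hconic _ _ _ (.inr (.inr ⟨hk₂ _ z₂, hl₂ _ z₂'⟩))
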